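/- arXiv:2501.01562 — 5 statements merged into one kernel-verified Lean document; each statement's English description precedes it below -/
import Mathlib

section
/- (Lemma 5.1.) Let F be a field of characteristic zero, k,m ≥ 1 integers, n = km. Identify Fin n with {0,…,n−1} and define r : Fin n → Fin k by r(q) = q mod k and b : Fin n → Fin m by b(q) = q div k. Let R = {π ∈ Perm(Fin n) : r ∘ π = r} and C = {π ∈ Perm(Fin n) : b ∘ π = b} (these are the row and column stabilizers of the standard Young tableau of rectangular shape (m^k) whose entry in row i and column j is (j−1)k+i). Then, in the free algebra FreeAlgebra F (Fin k) with generators y₀,…,y_{k−1}: ∑_{σ∈R, τ∈C} sgn(τ) · y_{r(σ(τ(0)))} y_{r(σ(τ(1)))} ⋯ y_{r(σ(τ(n−1)))} = (m!)^k · (∑_{π∈Perm(Fin k)} sgn(π) y_{π(0)} y_{π(1)} ⋯ y_{π(k−1)})^m. -/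
open scoped Classical

noncomputable section

namespace SSA

lemma sum_fst_preserving {α β γ M : Type*} [Fintype α] [Fintype β] [Fintype γ]
    [DecidableEq α] [DecidableEq β] [DecidableEq γ]
    [AddCommMonoid M] (e : α × β ≃ γ) (p : Equiv.Perm γ → Prop) [DecidablePred p]
    (hp : ∀ τ, p τ ↔ ∀ q, (e.symm (τ q)).1 = (e.symm q).1) (f : Equiv.Perm γ → M) :
    ∑ τ ∈ Finset.univ.filter p, f τ
    = ∑ s : α → Equiv.Perm β, f (e.permCongr (Equiv.prodCongrRight s)) := by
  symm
  refine Finset.sum_bij (fun s _ => e.permCongr (Equiv.prodCongrRight s)) ?_ ?_ ?_ ?_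
  · intro s _
    simp [Equiv.permCongr_apply, hp]
  · intro s _ t _ h
    have h2 := e.permCongr.injective h
    funext a
    ext b
    have h3 := congrArg (fun p : Equiv.Perm (α × β) => (p (a, b)).2) h2
    simpa using h3
  · intro τ hτ
    have hτ := (hp τ).1 (Finset.mem_filter.1 hτ).2
    have key : ∀ a b, (e.symm (τ (e (a, b)))).1 = a := fun a b => by simpa using hτ (e (a, b))
    have inj : ∀ a, Function.Injective (fun b => (e.symm (τ (e (a, b)))).2) := by
      intro a b c hbc
      have : e.symm (τ (e (a, b))) = e.symm (τ (e (a, c))) :=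
        Prod.ext ((key a b).trans (key a c).symm) hbc
      simpa using this
    refine ⟨fun a => Equiv.ofBijective _ (Finite.injective_iff_bijective.1 (inj a)),
      Finset.mem_univ _, ?_⟩
    ext q
    obtain ⟨⟨a, b⟩, rfl⟩ := e.surjective q
    simp only [Equiv.permCongr_apply, Equiv.symm_apply_apply, Equiv.prodCongrRight_apply,
      Equiv.ofBijective_apply]
    rw [← Equiv.eq_symm_apply]
    exact Prod.ext (key a b).symm rfl
  · intro s _
    rfl

lemma sum_pow_ofFn {ι A : Type*} [Fintype ι] [Semiring A] (g : ι → A) (m : ℕ) :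
    (∑ i, g i) ^ m = ∑ s : Fin m → ι, (List.ofFn fun b => g (s b)).prod := by
  induction m with
  | zero => simp
  | succ m ih =>
    rw [pow_succ', ih, Finset.sum_mul_sum, ← Finset.sum_product', Finset.univ_product_univ,
      ← (Fin.consEquiv (fun _ : Fin (m + 1) => ι)).sum_comp]
    simp [List.ofFn_succ, Fin.consEquiv]

lemma prod_smul_ofFn {A : Type*} [Ring A] (m : ℕ) (c : Fin m → ℤ) (g : Fin m → A) :
    (List.ofFn fun b => c b • g b).prod = (∏ b, c b) • (List.ofFn g).prod := by
  induction m with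
  | zero => simp
  | succ m ih =>
    rw [List.ofFn_succ, List.prod_cons, ih, Fin.prod_univ_succ, List.ofFn_succ, List.prod_cons,
      smul_mul_smul_comm]

def tabEquiv (k m : ℕ) : Fin m × Fin k ≃ Fin (k * m) :=
  finProdFinEquiv.trans (finCongr (Nat.mul_comm m k))

lemma tabEquiv_val (k m : ℕ) (x : Fin m × Fin k) :
    (tabEquiv k m x : ℕ) = x.2 + k * x.1 := rfl

lemma tabEquiv_symm_fst (k m : ℕ) (q : Fin (k * m)) :
    (((tabEquiv k m).symm q).1 : ℕ) = q / k := by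
  obtain ⟨⟨a, b⟩, rfl⟩ := (tabEquiv k m).surjective q
  have hk : 0 < k := b.pos
  rw [Equiv.symm_apply_apply, tabEquiv_val, Nat.add_mul_div_left _ _ hk,
    Nat.div_eq_of_lt b.2, zero_add]

lemma tabEquiv_symm_snd (k m : ℕ) (q : Fin (k * m)) :
    (((tabEquiv k m).symm q).2 : ℕ) = q % k := by
  obtain ⟨⟨a, b⟩, rfl⟩ := (tabEquiv k m).surjective q
  rw [Equiv.symm_apply_apply, tabEquiv_val, Nat.add_mul_mod_self_left, Nat.mod_eq_of_lt b.2]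

lemma card_rows (k m : ℕ) : (Finset.univ.filter
    (fun σ : Equiv.Perm (Fin (k * m)) => ∀ q, ((σ q : ℕ) % k = (q : ℕ) % k))).card
    = m.factorial ^ k := by
  rw [Finset.card_eq_sum_ones,
    sum_fst_preserving ((Equiv.prodComm _ _).trans (tabEquiv k m)) _ (fun τ => by
      simp only [Equiv.symm_trans_apply, Equiv.prodComm_symm, Equiv.prodComm_apply,
        Prod.fst_swap, Fin.ext_iff, tabEquiv_symm_snd]) (fun _ => 1)]
  simp [Fintype.card_perm]

/-- **Lemma 5.1.**

Let `F` be a field of characteristic zero, `k, m ≥ 1`, `n = km`. With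
`r(q) = q mod k`, `b(q) = q div k`, `R = {π : r ∘ π = r}` and `C = {π : b ∘ π = b}`
(the row and column stabilizers of the standard rectangular tableau of shape `(m^k)`
whose entry in row `i`, column `j` is `(j-1)k + i`), in the free algebra
`FreeAlgebra F (Fin k)` on generators `y₀,…,y_{k-1}` one has
`∑_{σ∈R, τ∈C} sgn(τ) y_{r(σ(τ(0)))} ⋯ y_{r(σ(τ(n-1)))}
  = (m!)^k • (∑_{π ∈ S_k} sgn(π) y_{π(0)} ⋯ y_{π(k-1)})^m`. -/
theorem rectangular_symmetrizer_eq_standard_power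
    (F : Type*) [Field F] [CharZero F] (k m : ℕ) (hk : 1 ≤ k) (hm : 1 ≤ m) :
    ∑ σ ∈ Finset.univ.filter
        (fun σ : Equiv.Perm (Fin (k * m)) => ∀ q, ((σ q : ℕ) % k = (q : ℕ) % k)),
      ∑ τ ∈ Finset.univ.filter
          (fun τ : Equiv.Perm (Fin (k * m)) => ∀ q, ((τ q : ℕ) / k = (q : ℕ) / k)),
        (Equiv.Perm.sign τ : ℤ) •
          (List.ofFn fun q : Fin (k * m) =>
            FreeAlgebra.ι F (⟨(σ (τ q) : ℕ) % k, Nat.mod_lt _ hk⟩ : Fin k)).prod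
    = (Nat.factorial m) ^ k •
        (∑ π : Equiv.Perm (Fin k),
          (Equiv.Perm.sign π : ℤ) •
            (List.ofFn fun i : Fin k => FreeAlgebra.ι F (π i)).prod) ^ m := by
  have step : ∀ σ ∈ Finset.univ.filter
        (fun σ : Equiv.Perm (Fin (k * m)) => ∀ q, ((σ q : ℕ) % k = (q : ℕ) % k)),
      ∑ τ ∈ Finset.univ.filter
          (fun τ : Equiv.Perm (Fin (k * m)) => ∀ q, ((τ q : ℕ) / k = (q : ℕ) / k)),
        (Equiv.Perm.sign τ : ℤ) •
          (List.ofFn fun q : Fin (k * m) =>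
            FreeAlgebra.ι F (⟨(σ (τ q) : ℕ) % k, Nat.mod_lt _ hk⟩ : Fin k)).prod
      = (∑ π : Equiv.Perm (Fin k),
          (Equiv.Perm.sign π : ℤ) •
            (List.ofFn fun i : Fin k => FreeAlgebra.ι F (π i)).prod) ^ m := by
    intro σ hσ
    have hσ := (Finset.mem_filter.1 hσ).2
    simp only [hσ]
    rw [sum_fst_preserving (tabEquiv k m) _ (fun τ => by
      simp only [Fin.ext_iff, tabEquiv_symm_fst]) (fun τ => (Equiv.Perm.sign τ : ℤ) •
          (List.ofFn fun q : Fin (k * m) =>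
            FreeAlgebra.ι F (⟨(τ q : ℕ) % k, Nat.mod_lt _ hk⟩ : Fin k)).prod), sum_pow_ofFn]
    refine Finset.sum_congr rfl fun s _ => ?_
    rw [prod_smul_ofFn, Equiv.Perm.sign_permCongr, Equiv.Perm.sign_prodCongrRight]
    congr 1
    · simp
    · rw [List.ofFn_mul', List.prod_flatten, List.map_ofFn]
      congr 2
      funext b
      simp only [Function.comp]
      congr 2
      funext i
      congr 1
      have hq : ∀ h, (⟨k * (b : ℕ) + i, h⟩ : Fin (k * m)) = tabEquiv k m (b, i) := fun h =>
        Fin.ext (by simp [tabEquiv_val, Nat.add_comm])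
      apply Fin.ext
      simp only [hq, Equiv.permCongr_apply, Equiv.symm_apply_apply, Equiv.prodCongrRight_apply]
      rw [← tabEquiv_symm_snd, Equiv.symm_apply_apply]
  rw [Finset.sum_congr rfl step, Finset.sum_const, card_rows]

end SSA
end
end

section
/- (Lemma 2.2.) Let F be a field of characteristic zero and A a #-superalgebra over F. Then for every n ≥ 1, the n-th #-graded codimension satisfies c_n^{grs}(A) ≤ 4ⁿ · c_n(A). -/
open scoped Classical

noncomputable section

namespace SSA

/-- Ordered product of a list of elements of a (possibly non-unital) multiplicative
structure; `0` for the empty list. -/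
def listProd {A : Type*} [Mul A] [Zero A] : List A → A
  | [] => 0
  | [a] => a
  | a :: b :: l => a * listProd (b :: l)

/-- The ordered product `a 0 * a 1 * ⋯ * a (n-1)`. -/
def finProd {A : Type*} [Mul A] [Zero A] {n : ℕ} (a : Fin n → A) : A :=
  listProd (List.ofFn a)

/-- `A` is a PI-algebra over `F`: it satisfies a nontrivial multilinear polynomial identity. -/
def IsPI (F A : Type*) [Field F] [NonUnitalRing A] [Module F A] : Prop :=
  ∃ n : ℕ, 1 ≤ n ∧ ∃ c : Equiv.Perm (Fin n) → F, c ≠ 0 ∧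
    ∀ a : Fin n → A, ∑ σ : Equiv.Perm (Fin n), c σ • finProd (fun i => a (σ i)) = 0

variable (F : Type*) [Field F]

/-- A `#`-superalgebra: an associative (not necessarily unital) `F`-algebra `A` with a
`ℤ₂`-grading `A = A₀ ⊕ A₁` and a linear map `#` which is a graded involution or a
superinvolution. -/
structure SuperAlg (A : Type*) [NonUnitalRing A] [Module F A]
    [SMulCommClass F A A] [IsScalarTower F A A] : Type _ where
  A0 : Submodule F A
  A1 : Submodule F A
  sup_eq_top : A0 ⊔ A1 = ⊤
  inf_eq_bot : A0 ⊓ A1 = ⊥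
  mul_mem00 : ∀ a ∈ A0, ∀ b ∈ A0, a * b ∈ A0
  mul_mem01 : ∀ a ∈ A0, ∀ b ∈ A1, a * b ∈ A1
  mul_mem10 : ∀ a ∈ A1, ∀ b ∈ A0, a * b ∈ A1
  mul_mem11 : ∀ a ∈ A1, ∀ b ∈ A1, a * b ∈ A0
  sharp : A →ₗ[F] A
  sharp_sharp : ∀ a, sharp (sharp a) = a
  sharp_mem0 : ∀ a ∈ A0, sharp a ∈ A0
  sharp_mem1 : ∀ a ∈ A1, sharp a ∈ A1
  gradedInvolution_or_superInvolution :
    (∀ a b : A, sharp (a * b) = sharp b * sharp a) ∨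
    ((∀ a ∈ A0, ∀ b ∈ A0, sharp (a * b) = sharp b * sharp a) ∧
     (∀ a ∈ A0, ∀ b ∈ A1, sharp (a * b) = sharp b * sharp a) ∧
     (∀ a ∈ A1, ∀ b ∈ A0, sharp (a * b) = sharp b * sharp a) ∧
     (∀ a ∈ A1, ∀ b ∈ A1, sharp (a * b) = -(sharp b * sharp a)))

variable {F}

/-- The four components `A₀⁺, A₀⁻, A₁⁺, A₁⁻` of a `#`-superalgebra (types `0,1,2,3`). -/
def SuperAlg.comp {A : Type*} [NonUnitalRing A] [Module F A]
    [SMulCommClass F A A] [IsScalarTower F A A] (S : SuperAlg F A) (i : Fin 4) :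
    Submodule F A :=
  (if i = 0 ∨ i = 1 then S.A0 else S.A1) ⊓
    LinearMap.ker (S.sharp - (if i = 0 ∨ i = 2 then (1 : F) else (-1 : F)) • LinearMap.id)

/-- A partition of `k`, given by its (non-increasing) sequence of row lengths. -/
structure NPartition (k : ℕ) where
  part : ℕ → ℕ
  antitone : Antitone part
  part_eq_zero : ∀ i, k ≤ i → part i = 0
  sum_eq : ∑ i ∈ Finset.range k, part i = k

/-- The cells of the Young diagram of a partition. -/
abbrev NPartition.Cell {k : ℕ} (μ : NPartition k) : Type :=
  {p : ℕ × ℕ // p.2 < μ.part p.1}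

/-- A Young tableau of shape `μ ⊢ k`: a bijective filling of the diagram with `1,…,k`. -/
abbrev YTableau {k : ℕ} (μ : NPartition k) : Type :=
  Fin k ≃ μ.Cell

/-- The row stabilizer of a tableau. -/
def rowStab {k : ℕ} {μ : NPartition k} (T : YTableau μ) : Set (Equiv.Perm (Fin k)) :=
  {π | ∀ a, (T (π a)).1.1 = (T a).1.1}

/-- The column stabilizer of a tableau. -/
def colStab {k : ℕ} {μ : NPartition k} (T : YTableau μ) : Set (Equiv.Perm (Fin k)) :=
  {π | ∀ a, (T (π a)).1.2 = (T a).1.2}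

/-- A standard Young tableau: entries increase along rows and down columns. -/
def YTableau.Standard {k : ℕ} {μ : NPartition k} (T : YTableau μ) : Prop :=
  ∀ c c' : μ.Cell,
    ((c.1.1 = c'.1.1 ∧ c.1.2 < c'.1.2) ∨ (c.1.2 = c'.1.2 ∧ c.1.1 < c'.1.1)) →
      T.symm c < T.symm c'

/-- The partition `μ` lies in the infinite hook `H(d,l)`, i.e. `μ_{d+1} ≤ l`. -/
def InHook (d l : ℕ) {k : ℕ} (μ : NPartition k) : Prop :=
  μ.part d ≤ l

variable (F)

/-- The Young symmetrizer `e_T = ∑_{σ ∈ R_T, τ ∈ C_T} sgn(τ)·στ`. -/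
def youngSym {k : ℕ} {μ : NPartition k} (T : YTableau μ) :
    MonoidAlgebra F (Equiv.Perm (Fin k)) :=
  ∑ σ ∈ Finset.univ.filter (· ∈ rowStab T),
    ∑ τ ∈ Finset.univ.filter (· ∈ colStab T),
      (Equiv.Perm.sign τ : ℤ) • MonoidAlgebra.single (σ * τ) (1 : F)

/-- The function `σ ↦ trace of left multiplication by `σ` on the left ideal generated by `e`;
for `e` a Young symmetrizer of shape `λ` this is the irreducible character `χ_λ`. -/
def idealChar {k : ℕ} (e : MonoidAlgebra F (Equiv.Perm (Fin k)))
    (σ : Equiv.Perm (Fin k)) : F :=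
  LinearMap.trace F _
    ((LinearMap.mulLeft F (MonoidAlgebra.single σ (1 : F))).restrict
      (p := (Submodule.span (MonoidAlgebra F (Equiv.Perm (Fin k))) {e}).restrictScalars F)
      (q := (Submodule.span (MonoidAlgebra F (Equiv.Perm (Fin k))) {e}).restrictScalars F)
      (fun x hx => by
        simp only [Submodule.restrictScalars_mem] at hx ⊢
        simpa [smul_eq_mul] using
          (Submodule.span (MonoidAlgebra F (Equiv.Perm (Fin k))) {e}).smul_mem
            (MonoidAlgebra.single σ (1 : F)) hx))

/-- The set of variables for a multidegree `⟨n⟩ = (n₁,n₂,n₃,n₄)`: the disjoint union of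
`Fin n₁, …, Fin n₄`, a type-`i` variable being evaluated in the `i`-th component. -/
abbrev MVar (n : Fin 4 → ℕ) : Type :=
  Σ i : Fin 4, Fin (n i)

/-- The group `S⟨n⟩ = S_{n₁} × S_{n₂} × S_{n₃} × S_{n₄}`. -/
abbrev MGroup (n : Fin 4 → ℕ) : Type :=
  ∀ i : Fin 4, Equiv.Perm (Fin (n i))

/-- The space `P⟨n⟩` of multilinear `#`-superpolynomials: a function `c` represents
`∑_{ord} c(ord) x_{ord(1)} ⋯ x_{ord(n)}`. -/
abbrev MPoly (F : Type*) (n : Fin 4 → ℕ) : Type _ :=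
  (Fin (∑ i, n i) ≃ MVar n) → F

variable {F} in
/-- The (left) action of `S⟨n⟩` on `P⟨n⟩` by relabeling the type-`i` variable indices. -/
def permMPoly {n : Fin 4 → ℕ} (g : MGroup n) (c : MPoly F n) : MPoly F n :=
  fun ord => c (ord.trans (Equiv.sigmaCongrRight fun i => ((g i)⁻¹ : Equiv.Perm (Fin (n i)))))

variable {F} in
/-- `c ∈ P⟨n⟩` is a `#`-superidentity of `A`: every admissible evaluation
(type-`i` variables in the `i`-th component) vanishes. -/
def MIsIdentity {A : Type*} [NonUnitalRing A] [Module F A]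
    [SMulCommClass F A A] [IsScalarTower F A A] (S : SuperAlg F A)
    {n : Fin 4 → ℕ} (c : MPoly F n) : Prop :=
  ∀ a : MVar n → A, (∀ v : MVar n, a v ∈ S.comp v.1) →
    ∑ ord : Fin (∑ i, n i) ≃ MVar n, c ord • finProd (fun j => a (ord j)) = 0

/-- The Young symmetrizer `e_{T⟨μ⟩}` of a Young multitableau, as an element of
`FS⟨n⟩ = MonoidAlgebra F S⟨n⟩`. -/
def multiYoungSym {n : Fin 4 → ℕ} {μ : ∀ i : Fin 4, NPartition (n i)}
    (T : ∀ i : Fin 4, YTableau (μ i)) : MonoidAlgebra F (MGroup n) :=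
  ∑ σ ∈ Finset.univ.filter (fun σ : MGroup n => ∀ i, σ i ∈ rowStab (T i)),
    ∑ τ ∈ Finset.univ.filter (fun τ : MGroup n => ∀ i, τ i ∈ colStab (T i)),
      (∏ i, (Equiv.Perm.sign (τ i) : ℤ)) • MonoidAlgebra.single (σ * τ) (1 : F)

/-- The element `e_{T⟨μ⟩} · f`, for `f ∈ P⟨n⟩`. -/
def symAct {n : Fin 4 → ℕ} {μ : ∀ i : Fin 4, NPartition (n i)}
    (T : ∀ i : Fin 4, YTableau (μ i)) (c : MPoly F n) : MPoly F n :=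
  ∑ σ ∈ Finset.univ.filter (fun σ : MGroup n => ∀ i, σ i ∈ rowStab (T i)),
    ∑ τ ∈ Finset.univ.filter (fun τ : MGroup n => ∀ i, τ i ∈ colStab (T i)),
      (∏ i, (Equiv.Perm.sign (τ i) : ℤ)) • permMPoly (σ * τ) c

/-- The `n`-th (ordinary) codimension of `A`: the dimension of the span, inside the space
of maps `Aⁿ → A`, of the maps `(a₁,…,aₙ) ↦ a_{σ(1)} ⋯ a_{σ(n)}`, `σ ∈ S_n`. -/
def ordCodim (F A : Type*) [Field F] [NonUnitalRing A] [Module F A] (n : ℕ) : ℕ :=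
  Module.finrank F ↥(Submodule.span F
    (Set.range fun σ : Equiv.Perm (Fin n) =>
      fun a : Fin n → A => finProd fun i => a (σ i)))

variable {F} in
/-- The `n`-th `#`-graded codimension of `A`: the dimension of the span, inside the space
of maps `Wⁿ → A` with `W = A₀⁺ × A₀⁻ × A₁⁺ × A₁⁻`, of the maps
`(x₁,…,xₙ) ↦ x_{σ(1)}^{(t(σ(1)))} ⋯ x_{σ(n)}^{(t(σ(n)))}` over all `σ ∈ S_n` and all
type assignments `t : Fin n → Fin 4`. -/
def grsCodim {A : Type*} [NonUnitalRing A] [Module F A]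
    [SMulCommClass F A A] [IsScalarTower F A A] (S : SuperAlg F A) (n : ℕ) : ℕ :=
  Module.finrank F ↥(Submodule.span F
    (Set.range fun p : Equiv.Perm (Fin n) × (Fin n → Fin 4) =>
      fun x : Fin n → (∀ i : Fin 4, ↥(S.comp i)) =>
        finProd fun j => ((x (p.1 j)) (p.2 (p.1 j)) : A)))

/-- **Lemma 2.2.** For a `#`-superalgebra `A` over a field of characteristic zero,
`c_n^{grs}(A) ≤ 4ⁿ · c_n(A)` for every `n ≥ 1`. -/
theorem grs_codim_le_four_pow_mul_codim
    (F A : Type*) [Field F] [CharZero F] [NonUnitalRing A] [Module F A]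
    [SMulCommClass F A A] [IsScalarTower F A A] (S : SuperAlg F A)
    (n : ℕ) (hn : 1 ≤ n) :
    grsCodim S n ≤ 4 ^ n * ordCodim F A n := by
  classical
  unfold grsCodim ordCodim
  set V := Submodule.span F
    (Set.range fun σ : Equiv.Perm (Fin n) =>
      fun a : Fin n → A => finProd fun i => a (σ i)) with hV
  haveI : FiniteDimensional F V := FiniteDimensional.span_of_finite F (Set.finite_range _)
  let L : (Fin n → Fin 4) →
      (((Fin n → A) → A) →ₗ[F] ((Fin n → (∀ i : Fin 4, ↥(S.comp i))) → A)) := fun t =>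
    LinearMap.funLeft F A (fun x i => ((x i) (t i) : A))
  let Φ : ((Fin n → Fin 4) → V) →ₗ[F] ((Fin n → (∀ i : Fin 4, ↥(S.comp i))) → A) :=
    ∑ t, (L t ∘ₗ V.subtype) ∘ₗ LinearMap.proj t
  have hle : Submodule.span F
    (Set.range fun p : Equiv.Perm (Fin n) × (Fin n → Fin 4) =>
      fun x : Fin n → (∀ i : Fin 4, ↥(S.comp i)) =>
        finProd fun j => ((x (p.1 j)) (p.2 (p.1 j)) : A)) ≤ LinearMap.range Φ := by
    rw [Submodule.span_le]
    rintro _ ⟨⟨σ, t⟩, rfl⟩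
    refine ⟨Pi.single t ⟨_, Submodule.subset_span ⟨σ, rfl⟩⟩, ?_⟩
    simp only [Φ, LinearMap.sum_apply, LinearMap.comp_apply, LinearMap.proj_apply]
    rw [Finset.sum_eq_single t]
    · rw [Pi.single_eq_same]
      rfl
    · intro b _ hb
      rw [Pi.single_eq_of_ne hb, map_zero, map_zero]
    · intro h
      exact absurd (Finset.mem_univ t) h
  calc _ ≤ Module.finrank F (LinearMap.range Φ) := Submodule.finrank_mono hle
    _ ≤ Module.finrank F ((Fin n → Fin 4) → V) := LinearMap.finrank_range_le Φ
    _ = _ := by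
      rw [Module.finrank_pi_fintype]
      simp

end SSA
end
end

section
/- (Corollary 2.3.) Let F be a field of characteristic zero and A a #-superalgebra over F. If A is a PI-algebra, then its sequence of #-graded codimensions is exponentially bounded: there is a real number D ≥ 1 such that c_n^{grs}(A) ≤ Dⁿ for every n ≥ 1. -/
open scoped Classical

noncomputable section

namespace SSA

variable (F : Type*) [Field F]

variable {F}

variable (F)

section Aux

lemma sublist_blocks {α : Type*} {s l : List α} (h : s.Sublist l) :
    ∃ (w0 : List α) (ws : List (List α)),
      List.Forall₂ (fun x w => ∃ u, w = x :: u) s ws ∧ l = w0 ++ ws.flatten := by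
  induction h with
  | slnil => exact ⟨[], [], List.Forall₂.nil, rfl⟩
  | cons a h ih =>
    obtain ⟨w0, ws, h1, h2⟩ := ih
    exact ⟨a :: w0, ws, h1, by simp [h2]⟩
  | cons_cons a h ih =>
    obtain ⟨w0, ws, h1, h2⟩ := ih
    exact ⟨[], (a :: w0) :: ws, List.Forall₂.cons ⟨w0, rfl⟩ h1, by simp [h2]⟩

lemma append_lt_left {α : Type*} [LinearOrder α] (l : List α) {a b : List α} (h : a < b) :
    l ++ a < l ++ b := by
  induction l with
  | nil => simpa using h
  | cons x l ih => simpa [List.cons_lt_cons_iff] using ih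

lemma flatten_lt {α : Type*} [LinearOrder α] {d : ℕ} (f g : Fin d → List α) (i : Fin d)
    (hj : ∀ j < i, f j = g j) (hi : ∃ x u y v, f i = x :: u ∧ g i = y :: v ∧ x < y) :
    (List.ofFn f).flatten < (List.ofFn g).flatten := by
  induction d with
  | zero => exact i.elim0
  | succ d ih =>
    simp only [List.ofFn_succ, List.flatten_cons]
    induction i using Fin.cases with
    | zero =>
      obtain ⟨x, u, y, v, h1, h2, h3⟩ := hi
      rw [h1, h2]
      simp [List.cons_lt_cons_iff, h3]
    | succ i =>
      rw [hj 0 (Fin.succ_pos i)]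
      apply append_lt_left
      exact ih _ _ i (fun j hji => hj _ (Fin.succ_lt_succ_iff.2 hji)) hi

lemma perm_flatten_lt {α : Type*} [LinearOrder α] {d : ℕ} (w : Fin d → List α)
    (x : Fin d → α) (hx : StrictAnti x) (hw : ∀ i, ∃ u, w i = x i :: u)
    (τ : Equiv.Perm (Fin d)) (hτ : τ ≠ 1) :
    (List.ofFn (fun i => w (τ i))).flatten < (List.ofFn w).flatten := by
  have hex : ∃ i, τ i ≠ i := by
    by_contra hc
    push Not at hc
    exact hτ (Equiv.ext hc)
  obtain ⟨i, hi, hmin⟩ := WellFounded.has_min (wellFounded_lt (α := Fin d)) {i | τ i ≠ i} hex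
  have hmin' : ∀ j < i, τ j = j := by
    intro j hj
    by_contra hc
    exact hmin j hc hj
  have hgt : i < τ i := by
    rcases lt_trichotomy i (τ i) with h | h | h
    · exact h
    · exact absurd h.symm hi
    · exact absurd (τ.injective (hmin' _ h)) hi
  apply flatten_lt _ _ i
  · intro j hj
    simp [hmin' j hj]
  · obtain ⟨u, hu⟩ := hw (τ i)
    obtain ⟨v, hv⟩ := hw i
    exact ⟨_, u, _, v, hu, hv, hx hgt⟩

/-- no strictly decreasing sublist of length d -/
def GoodL {α : Type*} [LinearOrder α] (d : ℕ) (l : List α) : Prop :=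
  ∀ s : List α, s.Sublist l → s.length = d → ¬ s.Pairwise (· > ·)

lemma not_good_blocks {α : Type*} [LinearOrder α] {d : ℕ} {l : List α} (h : ¬ GoodL d l) :
    ∃ (w0 : List α) (w : Fin d → List α) (x : Fin d → α), StrictAnti x ∧
      (∀ i, ∃ u, w i = x i :: u) ∧ l = w0 ++ (List.ofFn w).flatten := by
  unfold GoodL at h
  push Not at h
  obtain ⟨s, hs, hd, hp⟩ := h
  subst hd
  obtain ⟨w0, ws, h1, h2⟩ := sublist_blocks hs
  have hl := h1.length_eq
  refine ⟨w0, fun i => ws.get (i.cast hl), s.get, ?_, ?_, ?_⟩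
  · intro i j hij
    exact List.pairwise_iff_get.1 hp i j hij
  · intro i
    exact h1.get i.2 (by omega)
  · rw [h2]
    congr 2
    apply List.ext_get
    · simp [hl]
    · intro n h1 h2
      simp

variable {F A : Type*} [Field F] [NonUnitalRing A] [Module F A]
    [SMulCommClass F A A] [IsScalarTower F A A]

lemma inr_listProd (l : List A) (hl : l ≠ []) :
    (Unitization.inr (listProd l) : Unitization F A)
      = (l.map (fun a => (Unitization.inr a : Unitization F A))).prod := by
  induction l with
  | nil => exact absurd rfl hl
  | cons a l ih =>
    cases l with
    | nil => simp [listProd]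
    | cons b l =>
      rw [listProd, Unitization.inr_mul, ih (by simp)]
      simp

lemma prod_map_flatten {α M : Type*} [Monoid M] (f : α → M) (L : List (List α)) :
    (L.flatten.map f).prod = (L.map (fun w => (w.map f).prod)).prod := by
  induction L with
  | nil => simp
  | cons a L ih =>
    rw [List.flatten_cons, List.map_append, List.prod_append, ih, List.map_cons, List.prod_cons]

/-- monomials as functions -/
def Mon {n : ℕ} (l : List (Fin n)) : (Fin n → A) → A := fun a => listProd (l.map a)

lemma Mon_relation {d : ℕ} (hd : 1 ≤ d) (c : Equiv.Perm (Fin d) → F)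
    (hc : ∀ a : Fin d → A, ∑ σ : Equiv.Perm (Fin d), c σ • finProd (fun i => a (σ i)) = 0)
    {n : ℕ} (w0 : List (Fin n)) (w : Fin d → List (Fin n)) (hw : ∀ i, w i ≠ []) :
    ∑ σ : Equiv.Perm (Fin d), c σ •
      (Mon (w0 ++ (List.ofFn (fun i => w (σ i))).flatten) : (Fin n → A) → A) = 0 := by
  funext a
  have h := hc (fun i => listProd ((w i).map a))
  apply Unitization.inr_injective (R := F)
  have h' := congrArg (fun y : A => ((w0.map (fun j => (Unitization.inr (a j) : Unitization F A))).prod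
    * Unitization.inr y : Unitization F A)) h
  simp only [Unitization.inr_zero, mul_zero, Pi.zero_apply] at h' ⊢
  rw [← h']
  simp only [Finset.sum_apply, Pi.smul_apply]
  have e1 : ∀ g : Equiv.Perm (Fin d) → A, (Unitization.inr (∑ σ, g σ) : Unitization F A)
      = ∑ σ, Unitization.inr (g σ) := fun g => map_sum (Unitization.inrHom F F A) g _
  rw [e1, e1, Finset.mul_sum]
  refine Finset.sum_congr rfl fun σ _ => ?_
  rw [Unitization.inr_smul, Unitization.inr_smul, mul_smul_comm]
  congr 1
  have hne : List.ofFn (fun i => w (σ i)) ≠ [] := by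
    intro h0
    have := congrArg List.length h0
    simp at this
    omega
  unfold Mon finProd
  rw [inr_listProd, inr_listProd]
  · simp only [List.map_map, List.map_append, List.prod_append]
    congr 1
    rw [prod_map_flatten]
    rw [List.map_ofFn, List.map_ofFn]
    congr 2
    funext i
    simp only [Function.comp]
    rw [inr_listProd _ (by simpa using hw (σ i))]
    simp [Function.comp_def]
  · intro h0
    have := congrArg List.length h0
    simp at this
    omega
  · intro h0
    simp only [List.map_eq_nil_iff, List.append_eq_nil_iff, List.flatten_eq_nil_iff] at h0
    exact hw (σ ⟨0, hd⟩) (h0.2 _ (by simp))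

lemma Mon_mem_span {d : ℕ} (hd : 1 ≤ d) (c : Equiv.Perm (Fin d) → F) (hc0 : c ≠ 0)
    (hc : ∀ a : Fin d → A, ∑ σ : Equiv.Perm (Fin d), c σ • finProd (fun i => a (σ i)) = 0)
    {n : ℕ} (l0 l : List (Fin n)) (hl : l.Perm l0) :
    (Mon l : (Fin n → A) → A) ∈
      Submodule.span F ((fun l' => (Mon l' : (Fin n → A) → A)) '' {l' | l'.Perm l0 ∧ GoodL d l'}) := by
  have hfin : ({l' : List (Fin n) | l'.Perm l0}).Finite := by
    refine (List.finite_length_eq (Fin n) l0.length).subset ?_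
    intro l' h
    exact List.Perm.length_eq h
  have hwf := hfin.wellFoundedOn (r := fun a b : List (Fin n) => a < b)
  refine hwf.induction (P := fun l => (Mon l : (Fin n → A) → A) ∈
      Submodule.span F ((fun l' => (Mon l' : (Fin n → A) → A)) ''
        {l' | l'.Perm l0 ∧ GoodL d l'})) hl ?_
  clear hl l
  intro l hl ih
  by_cases hg : GoodL d l
  · exact Submodule.subset_span ⟨l, ⟨hl, hg⟩, rfl⟩
  obtain ⟨w0, w, x, hx, hw, rfl⟩ := not_good_blocks hg
  obtain ⟨σ0, hσ0⟩ := Function.ne_iff.1 hc0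
  have hrel := Mon_relation hd c hc w0 (fun i => w (σ0⁻¹ i)) (fun i => by
    obtain ⟨u, hu⟩ := hw (σ0⁻¹ i)
    rw [hu]
    exact List.cons_ne_nil _ _)
  rw [← Finset.add_sum_erase _ _ (Finset.mem_univ σ0)] at hrel
  have hinv : ∀ i, σ0⁻¹ (σ0 i) = i := fun i => σ0.symm_apply_apply i
  simp only [hinv] at hrel
  have hmem : c σ0 • (Mon (w0 ++ (List.ofFn w).flatten) : (Fin n → A) → A) ∈
      Submodule.span F ((fun l' => (Mon l' : (Fin n → A) → A)) ''
        {l' | l'.Perm l0 ∧ GoodL d l'}) := by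
    rw [eq_neg_of_add_eq_zero_left hrel]
    refine Submodule.neg_mem _ (Submodule.sum_mem _ fun σ hσ => Submodule.smul_mem _ _ ?_)
    apply ih
    · refine List.Perm.trans ?_ hl
      refine List.Perm.append_left _ (List.Perm.flatten ?_)
      exact Equiv.Perm.ofFn_comp_perm (σ0⁻¹ * σ) w
    · apply append_lt_left
      refine perm_flatten_lt w x hx hw (σ0⁻¹ * σ) ?_
      intro h1
      rw [inv_mul_eq_one] at h1
      exact (Finset.ne_of_mem_erase hσ) h1.symm
  have := Submodule.smul_mem _ (c σ0)⁻¹ hmem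
  rwa [inv_smul_smul₀ hσ0] at this

/-- length of longest decreasing subsequence ending at i -/
def pk {n : ℕ} (σ : Equiv.Perm (Fin n)) (i : Fin n) : ℕ :=
  (Finset.univ.filter (fun s : Finset (Fin n) =>
    StrictAntiOn σ (s : Set (Fin n)) ∧ i ∈ s ∧ ∀ j ∈ s, j ≤ i)).sup Finset.card

lemma pk_lt {n : ℕ} (σ : Equiv.Perm (Fin n)) {i j : Fin n} (hij : i < j) (h : σ j < σ i) :
    pk σ i < pk σ j := by
  have hne : (Finset.univ.filter (fun s : Finset (Fin n) =>
    StrictAntiOn σ (s : Set (Fin n)) ∧ i ∈ s ∧ ∀ j ∈ s, j ≤ i)).Nonempty :=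
    ⟨{i}, by simp⟩
  obtain ⟨s, hs, hcard⟩ := Finset.exists_mem_eq_sup _ hne Finset.card
  simp only [Finset.mem_filter, Finset.mem_univ, true_and] at hs
  obtain ⟨h1, h2, h3⟩ := hs
  have hjs : j ∉ s := fun hj => absurd (h3 j hj) (not_le.2 hij)
  have : (insert j s).card ≤ pk σ j := by
    apply Finset.le_sup (f := Finset.card)
    simp only [Finset.mem_filter, Finset.mem_univ, true_and]
    refine ⟨?_, by simp, ?_⟩
    · intro a ha b hb hab
      simp only [Finset.coe_insert, Set.mem_insert_iff, Finset.mem_coe] at ha hb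
      rcases ha with rfl | ha
      · rcases hb with rfl | hb
        · exact absurd hab (lt_irrefl _)
        · exact absurd (hab.trans_le (h3 b hb)) (not_lt.2 hij.le)
      · rcases hb with rfl | hb
        · exact h.trans_le (h1.antitoneOn ha h2 (h3 a ha))
        · exact h1 ha hb hab
    · intro k hk
      rcases Finset.mem_insert.1 hk with rfl | hk
      · exact le_rfl
      · exact (h3 k hk).trans hij.le
  rw [Finset.card_insert_of_notMem hjs] at this
  unfold pk at this ⊢
  omega

lemma pk_good {n d : ℕ} (hd : 1 ≤ d) (σ : Equiv.Perm (Fin n)) (h : GoodL d (List.ofFn σ)) (i : Fin n) :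
    pk σ i < d := by
  unfold pk
  rw [Finset.sup_lt_iff (by rw [bot_eq_zero]; omega)]
  intro s hs
  simp only [Finset.mem_filter, Finset.mem_univ, true_and] at hs
  by_contra hc
  push Not at hc
  let L := ((List.finRange n).filter (fun k => decide (k ∈ s)))
  have hL : L.length = s.card := by
    rw [← List.toFinset_card_of_nodup ((List.nodup_finRange n).filter _)]
    congr 1
    ext k
    simp
  refine h ((L.map σ).take d) ?_ ?_ ?_
  · refine (List.take_sublist _ _).trans ?_
    rw [List.ofFn_eq_map]
    exact List.filter_sublist.map _
  · simp [hL, hc]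
  · refine List.Pairwise.sublist (List.take_sublist _ _) ?_
    rw [List.pairwise_map]
    have hp : L.Pairwise (· < ·) := List.Pairwise.sublist List.filter_sublist (List.pairwise_lt_finRange n)
    refine hp.imp_of_mem ?_
    intro a b ha hb hab
    have ha' : a ∈ s := by simpa [L] using ha
    have hb' : b ∈ s := by simpa [L] using hb
    exact hs.1 ha' hb' hab

lemma pk_inj {n : ℕ} (σ τ : Equiv.Perm (Fin n)) (h1 : pk σ = pk τ)
    (h2 : (fun i => pk σ (σ.symm i)) = fun i => pk τ (τ.symm i)) : σ = τ := by
  have mono : ∀ (σ : Equiv.Perm (Fin n)) (k : ℕ),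
      StrictMono (fun i : {i // pk σ i = k} => σ i.1) := by
    intro σ k i j hij
    rcases lt_trichotomy (σ i.1) (σ j.1) with h | h | h
    · exact h
    · exact absurd (σ.injective h) (ne_of_lt hij)
    · have := pk_lt σ hij h
      rw [i.2, j.2] at this
      exact absurd this (lt_irrefl _)
  have rng : ∀ (σ : Equiv.Perm (Fin n)) (k : ℕ),
      Set.range (fun i : {i // pk σ i = k} => σ i.1) = {y | pk σ (σ.symm y) = k} := by
    intro σ k
    ext y
    constructor
    · rintro ⟨i, rfl⟩
      simpa using i.2
    · intro hy
      exact ⟨⟨σ.symm y, hy⟩, by simp⟩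
  have mτ : ∀ k, StrictMono (fun i : {i // pk σ i = k} => τ i.1) := by
    rw [h1]; exact mono τ
  have rτ : ∀ k, Set.range (fun i : {i // pk σ i = k} => τ i.1) = {y | pk τ (τ.symm y) = k} := by
    rw [h1]; exact rng τ
  ext i : 1
  have := ((mono σ (pk σ i)).range_inj (mτ (pk σ i))).1 (by
    rw [rng, rτ]
    ext y
    have := congrFun h2 y
    simp [this])
  exact congrFun this ⟨i, rfl⟩

lemma card_good {n d : ℕ} (hd : 1 ≤ d) :
    Fintype.card {σ : Equiv.Perm (Fin n) // GoodL d (List.ofFn σ)} ≤ (d * d) ^ n := by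
  have hcard : Fintype.card ((Fin n → Fin d) × (Fin n → Fin d)) = (d * d) ^ n := by
    simp [mul_pow]
  rw [← hcard]
  refine Fintype.card_le_of_injective (fun σ =>
    (fun i => ⟨pk σ.1 i, pk_good hd σ.1 σ.2 i⟩,
     fun i => ⟨pk σ.1 (σ.1.symm i), pk_good hd σ.1 σ.2 _⟩)) ?_
  intro σ τ h
  simp only [Prod.mk.injEq] at h
  apply Subtype.ext
  apply pk_inj
  · funext i
    simpa using congrFun h.1 i
  · funext i
    simpa using congrFun h.2 i

lemma exists_perm_of_list {n : ℕ} (l : List (Fin n)) (h : l.Perm (List.ofFn (id : Fin n → Fin n))) :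
    ∃ σ : Equiv.Perm (Fin n), l = List.ofFn σ := by
  have hlen : l.length = n := by simpa using h.length_eq
  have hnd : l.Nodup := h.nodup_iff.2 (List.nodup_ofFn.2 Function.injective_id)
  have hinj : Function.Injective (fun i : Fin n => l.get (i.cast hlen.symm)) := by
    intro i j hij
    have := List.nodup_iff_injective_get.1 hnd hij
    simpa using this
  refine ⟨Equiv.ofBijective _ (Finite.injective_iff_bijective.1 hinj), ?_⟩
  apply List.ext_get
  · simp [hlen]
  · intro k h1 h2
    simp

end Aux

/-- **Corollary 2.3.** If a `#`-superalgebra `A` over a field of characteristic zero is a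
PI-algebra, then its sequence of `#`-graded codimensions is exponentially bounded:
there is a real `D ≥ 1` with `c_n^{grs}(A) ≤ Dⁿ` for all `n ≥ 1`. -/
theorem grs_codim_exponentially_bounded
    (F A : Type*) [Field F] [CharZero F] [NonUnitalRing A] [Module F A]
    [SMulCommClass F A A] [IsScalarTower F A A] (S : SuperAlg F A) (hPI : IsPI F A) :
    ∃ D : ℝ, 1 ≤ D ∧ ∀ n : ℕ, 1 ≤ n → (grsCodim S n : ℝ) ≤ D ^ n := by
  obtain ⟨d, hd, c, hc0, hc⟩ := hPI
  refine ⟨((d * d * 4 : ℕ) : ℝ), ?_, ?_⟩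
  · have : 1 ≤ d * d * 4 := by nlinarith
    exact_mod_cast this
  intro n _
  have key : grsCodim S n ≤ (d * d * 4) ^ n := by
    let f : ({σ : Equiv.Perm (Fin n) // GoodL d (List.ofFn σ)} × (Fin n → Fin 4)) →
        ((Fin n → (∀ i : Fin 4, ↥(S.comp i))) → A) := fun p x =>
          finProd fun j => ((x (p.1.1 j)) (p.2 (p.1.1 j)) : A)
    have hle : Submodule.span F
        (Set.range fun p : Equiv.Perm (Fin n) × (Fin n → Fin 4) =>
          fun x : Fin n → (∀ i : Fin 4, ↥(S.comp i)) =>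
            finProd fun j => ((x (p.1 j)) (p.2 (p.1 j)) : A)) ≤
        Submodule.span F (Set.range f) := by
      rw [Submodule.span_le]
      rintro _ ⟨⟨σ, t⟩, rfl⟩
      let φ : (Fin n → (∀ i : Fin 4, ↥(S.comp i))) → (Fin n → A) := fun x i => (x i (t i) : A)
      have hm := Mon_mem_span hd c hc0 hc (List.ofFn (id : Fin n → Fin n)) (List.ofFn σ)
        (Equiv.Perm.ofFn_comp_perm σ id)
      have hm2 := Submodule.mem_map_of_mem (f := LinearMap.funLeft F A φ) hm
      rw [Submodule.map_span] at hm2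
      have e : ∀ τ : Equiv.Perm (Fin n), LinearMap.funLeft F A φ (Mon (List.ofFn τ)) =
          fun x => finProd fun j => ((x (τ j)) (t (τ j)) : A) := by
        intro τ
        funext x
        simp only [LinearMap.funLeft_apply, Mon, finProd, List.map_ofFn]
        rfl
      rw [e] at hm2
      refine Submodule.span_mono ?_ hm2
      rintro _ ⟨_, ⟨l, ⟨hl, hg⟩, rfl⟩, rfl⟩
      obtain ⟨τ, rfl⟩ := exists_perm_of_list l hl
      exact ⟨(⟨τ, hg⟩, t), (e τ).symm⟩
    have hfd : FiniteDimensional F ↥(Submodule.span F (Set.range f)) :=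
      FiniteDimensional.span_of_finite F (Set.finite_range f)
    calc grsCodim S n ≤ Module.finrank F ↥(Submodule.span F (Set.range f)) :=
          Submodule.finrank_mono hle
      _ ≤ Fintype.card ({σ : Equiv.Perm (Fin n) // GoodL d (List.ofFn σ)} × (Fin n → Fin 4)) :=
          finrank_range_le_card f
      _ ≤ (d * d * 4) ^ n := by
          rw [Fintype.card_prod, mul_pow]
          exact Nat.mul_le_mul (card_good hd) (by simp)
  exact_mod_cast key

end SSA
end
end

section
/- (Lemma 3.11, restated via the dimension of the minimal left ideal, which equals deg χ_λ.) Let F be a field of characteristic zero, q a positive real number, and m a positive integer with m² > e⁴q² (e the base of natural logarithms). Let λ = (m^m) be the square partition of n = m² and T any Young tableau of shape λ. Then the F-dimension of the left ideal F[Perm(Fin n)]·e_T (which equals the degree of the irreducible character χ_λ of S_n) is strictly greater than q^{m²}. -/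
open scoped Classical

noncomputable section

namespace SSA

variable (F : Type*) [Field F]

variable {F}

variable (F)

def diagProd (m : ℕ) : ℝ := ∏ k ∈ Finset.range m, (((k+1).factorial : ℝ) * (k.factorial : ℝ))

lemma fact_lb (k : ℕ) : (k:ℝ)^k ≤ Real.exp 1 ^ k * k.factorial := by
  have h := Real.pow_div_factorial_le_exp (k:ℝ) (by positivity) k
  rw [div_le_iff₀ (by positivity)] at h
  rwa [← Real.exp_nat_mul, mul_one]
lemma one_lb (k : ℕ) : ((k:ℝ)+1)^k ≤ Real.exp 1 * k^k := by
  rcases Nat.eq_zero_or_pos k with rfl | hk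
  · simp
  have hk' : (0:ℝ) < k := by exact_mod_cast hk
  have h := Real.add_one_le_exp (1/(k:ℝ))
  have h2 : (1/(k:ℝ)+1)^k ≤ Real.exp (1/k)^k := by gcongr
  rw [← Real.exp_nat_mul, mul_one_div_cancel hk'.ne'] at h2
  calc ((k:ℝ)+1)^k = (1/(k:ℝ)+1)^k * k^k := by rw [← mul_pow]; congr 1; field_simp; ring
    _ ≤ _ := by gcongr
lemma diagProd_lb (m : ℕ) : (m:ℝ)^(m^2) ≤ Real.exp 1 ^ (2 * m^2) * diagProd m := by
  induction m with
  | zero => simp [diagProd]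
  | succ m ih =>
    have hA : diagProd (m+1) = diagProd m * (((m+1).factorial : ℝ) * (m.factorial : ℝ)) := by
      simp [diagProd, Finset.prod_range_succ]
    have hA0 : 0 ≤ diagProd m := by unfold diagProd; positivity
    have h1 := one_lb m
    have h2 := fact_lb m
    have h3 := fact_lb (m+1)
    push_cast at h3 ⊢
    have he : (1:ℝ) ≤ Real.exp 1 := Real.one_le_exp (by norm_num)
    generalize Real.exp 1 = e at *
    calc ((m:ℝ)+1)^((m+1)^2) = (((m:ℝ)+1)^m)^m * ((m:ℝ)+1)^m * ((m:ℝ)+1)^(m+1) := by ring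
      _ ≤ (e * m^m)^m * (e * m^m) * (e^(m+1) * (m+1).factorial) := by gcongr
      _ = e^m * (m:ℝ)^(m^2) * (e * m^m) * (e^(m+1) * (m+1).factorial) := by ring
      _ ≤ e^m * (e ^ (2 * m^2) * diagProd m) * (e * (e^m * m.factorial)) * (e^(m+1) * (m+1).factorial) := by gcongr
      _ = e^(3*m+2) * (e ^ (2 * m^2) * diagProd m * m.factorial * (m+1).factorial) := by ring
      _ ≤ e^(4*m+2) * (e ^ (2 * m^2) * diagProd m * m.factorial * (m+1).factorial) := by
        gcongr
        omega
      _ = _ := by rw [hA]; ring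

/-- Cell content sum. -/
def diagIdx {k : ℕ} {μ : NPartition k} (T : YTableau μ) (a : Fin k) : ℕ :=
  (T a).1.1 + (T a).1.2

lemma diag_eq_one {k : ℕ} {μ : NPartition k} (T : YTableau μ)
    (σ τ : Equiv.Perm (Fin k)) (hσ : σ ∈ rowStab T) (hτ : τ ∈ colStab T)
    (hd : ∀ a, diagIdx T ((σ * τ) a) = diagIdx T a) : σ = 1 ∧ τ = 1 := by
  have hσ' : ∀ a, (T (σ a)).1.1 = (T a).1.1 := hσ
  have hτ' : ∀ a, (T (τ a)).1.2 = (T a).1.2 := hτ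
  have key : ∀ a, ((T (σ (τ a))).1.2 : ℤ) - (T (τ a)).1.2 = (T a).1.1 - (T (τ a)).1.1 := by
    intro a
    have h := hd a
    simp only [diagIdx, Equiv.Perm.mul_apply] at h
    have h1 := hσ' (τ a)
    have h2 := hτ' a
    omega
  have h1 : ∑ y, ((T y).1.1 : ℤ) * ((T (σ y)).1.2 - (T y).1.2) = 0 := by
    simp only [mul_sub, Finset.sum_sub_distrib]
    rw [sub_eq_zero, ← Equiv.sum_comp σ (fun y => ((T y).1.1 : ℤ) * (T y).1.2)]
    exact Finset.sum_congr rfl fun y _ => by rw [hσ' y]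
  rw [← Equiv.sum_comp τ] at h1
  simp only [key] at h1
  have h2 : ∑ y, (((T (τ y)).1.1 : ℤ)^2) = ∑ y, ((T y).1.1 : ℤ)^2 :=
    Equiv.sum_comp τ (fun y => ((T y).1.1 : ℤ)^2)
  have h3 : ∑ y, (((T (τ y)).1.1 : ℤ) - (T y).1.1)^2 = 0 := by
    have : ∀ y, (((T (τ y)).1.1 : ℤ) - (T y).1.1)^2 =
      ((T y).1.1 : ℤ)^2 - ((T (τ y)).1.1 : ℤ)^2 
        - 2 * ((T (τ y)).1.1 * (((T y).1.1 : ℤ) - (T (τ y)).1.1)) := fun y => by ring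
    simp only [this, Finset.sum_sub_distrib, ← Finset.mul_sum, h2]
    rw [h1]; simp
  rw [Finset.sum_eq_zero_iff_of_nonneg (fun _ _ => sq_nonneg _)] at h3
  have h4 : τ = 1 := by
    ext1 a
    apply T.injective
    apply Subtype.ext
    refine Prod.ext ?_ (hτ' a)
    have := pow_eq_zero_iff (two_ne_zero) |>.mp (h3 a (Finset.mem_univ _))
    simp only [Equiv.Perm.one_apply]
    omega
  subst h4
  refine ⟨?_, rfl⟩
  ext1 a
  apply T.injective
  apply Subtype.ext
  refine Prod.ext (hσ' a) ?_
  have := key a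
  simp only [Equiv.Perm.one_apply] at this ⊢
  omega

lemma coeff_youngSym (F : Type*) [Field F] {k : ℕ} {μ : NPartition k} (T : YTableau μ)
    (d : Equiv.Perm (Fin k)) (hd : ∀ a, diagIdx T (d a) = diagIdx T a) :
    (youngSym F T).coeff d = if d = 1 then 1 else 0 := by
  have h : (youngSym F T).coeff d = ∑ σ ∈ Finset.univ.filter (· ∈ rowStab T),
    ∑ τ ∈ Finset.univ.filter (· ∈ colStab T),
      (Equiv.Perm.sign τ : ℤ) • (if σ * τ = d then (1 : F) else 0) := by
    simp [youngSym, MonoidAlgebra.coeff_single, Finsupp.single_apply, Finsupp.finsetSum_apply]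
  rw [h]
  have h1 : ∀ σ ∈ Finset.univ.filter (· ∈ rowStab T),
      ∀ τ ∈ Finset.univ.filter (· ∈ colStab T), σ * τ = d → σ = 1 ∧ τ = 1 := by
    intro σ hσ τ hτ e
    simp only [Finset.mem_filter, Finset.mem_univ, true_and] at hσ hτ
    subst e
    exact diag_eq_one T σ τ hσ hτ hd
  split_ifs with hd1
  · subst hd1
    rw [Finset.sum_eq_single 1, Finset.sum_eq_single 1]
    · simp
    · intro τ hτ hne
      rw [if_neg (fun e => hne (by simpa using e)), smul_zero]
    · intro hh; exact absurd (by simp only [Finset.mem_filter, Finset.mem_univ, true_and]; exact fun a => rfl) hh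
    · intro σ hσ hne
      refine Finset.sum_eq_zero fun τ hτ => ?_
      rw [if_neg (fun e => hne (h1 σ hσ τ hτ e).1), smul_zero]
    · intro hh; exact absurd (by simp only [Finset.mem_filter, Finset.mem_univ, true_and]; exact fun a => rfl) hh
  · refine Finset.sum_eq_zero fun σ hσ => Finset.sum_eq_zero fun τ hτ => ?_
    rw [if_neg, smul_zero]
    intro e
    obtain ⟨r, t⟩ := h1 σ hσ τ hτ e
    exact hd1 (by rw [← e, r, t, mul_one])

lemma card_le_finrank (F : Type*) [Field F] {k : ℕ} {μ : NPartition k} (T : YTableau μ) :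
    Nat.card {g : Equiv.Perm (Fin k) // ∀ a, diagIdx T (g a) = diagIdx T a} ≤
      Module.finrank F
        ↥((Submodule.span (MonoidAlgebra F (Equiv.Perm (Fin k)))
            {youngSym F T}).restrictScalars F) := by
  set D := {g : Equiv.Perm (Fin k) // ∀ a, diagIdx T (g a) = diagIdx T a}
  set I := (Submodule.span (MonoidAlgebra F (Equiv.Perm (Fin k)))
            {youngSym F T}).restrictScalars F
  have hfin : Module.Finite F (MonoidAlgebra F (Equiv.Perm (Fin k))) := inferInstance
  let v : D → I := fun w => ⟨MonoidAlgebra.single w.1 (1 : F) * youngSym F T, by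
    rw [Submodule.restrictScalars_mem]
    exact Submodule.smul_mem _ _ (Submodule.mem_span_singleton_self _)⟩
  have hv : LinearIndependent F v := by
    rw [Fintype.linearIndependent_iff]
    intro c hc w
    have h := congrArg (fun x : I => (x : MonoidAlgebra F (Equiv.Perm (Fin k))).coeff w.1) hc
    have h2 : ∀ x : D, (v x : MonoidAlgebra F (Equiv.Perm (Fin k))).coeff w.1
        = if x = w then 1 else 0 := by
      intro x
      simp only [v, MonoidAlgebra.coeff_single_mul_apply, one_mul]
      rw [coeff_youngSym F T]
      · have : (x.1⁻¹ * w.1 = 1) ↔ x = w := by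
          rw [inv_mul_eq_one]; exact Subtype.ext_iff.symm
        simp only [this]
      · intro a
        have := x.2 (x.1⁻¹ (w.1 a))
        have h3 : x.1 (x.1⁻¹ (w.1 a)) = w.1 a := x.1.apply_symm_apply _
        rw [h3, w.2] at this
        exact this.symm
    simp [MonoidAlgebra.coeff_sum, MonoidAlgebra.coeff_smul, Finsupp.finsetSum_apply, h2] at h
    rw [Finset.sum_eq_single w (fun b _ hb => if_neg hb)
      (fun hb => absurd (Finset.mem_univ _) hb), if_pos rfl] at h
    exact h
  rw [Nat.card_eq_fintype_card]
  exact hv.fintype_card_le_finrank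

lemma card_diag (m : ℕ) (ν : NPartition (m ^ 2)) (hν : ∀ i, i < m → ν.part i = m)
    (T : YTableau ν) :
    ∏ k ∈ Finset.range m, ((k+1).factorial * k.factorial) ≤
    Nat.card {g : Equiv.Perm (Fin (m^2)) // ∀ a, diagIdx T (g a) = diagIdx T a} := by
  have hz : ∀ i, m ≤ i → ν.part i = 0 := by
    intro i hi
    by_contra hne
    have hi2 : i < m^2 := by
      by_contra h
      exact hne (ν.part_eq_zero i (not_lt.mp h))
    have h1 : ∑ j ∈ insert i (Finset.range m), ν.part j ≤ ∑ j ∈ Finset.range (m^2), ν.part j := by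
      apply Finset.sum_le_sum_of_subset
      intro j hj
      simp only [Finset.mem_insert, Finset.mem_range] at hj ⊢
      omega
    rw [Finset.sum_insert (by simp [hi]), ν.sum_eq,
      Finset.sum_congr rfl (fun j hj => hν j (Finset.mem_range.mp hj))] at h1
    simp only [Finset.sum_const, Finset.card_range, smul_eq_mul] at h1
    nlinarith [Nat.pos_of_ne_zero hne]
  have hlt : ∀ a, diagIdx T a < 2 * m := by
    intro a
    have h := (T a).2
    have h1 : (T a).1.1 < m := by
      by_contra h'
      rw [hz _ (not_lt.mp h')] at h
      omega
    rw [hν _ h1] at h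
    unfold diagIdx
    omega
  let f : Fin (m^2) → Fin (2*m) := fun a => ⟨diagIdx T a, hlt a⟩
  have hcard : Nat.card {g : Equiv.Perm (Fin (m^2)) // ∀ a, diagIdx T (g a) = diagIdx T a}
      = ∏ i : Fin (2*m), (Nat.card {a // f a = i}).factorial := by
    have := DomMulAct.stabilizer_card f
    simp only [← Nat.card_eq_fintype_card] at this
    rw [← this]
    refine Nat.card_congr (Equiv.subtypeEquivRight fun g => ?_)
    simp [funext_iff, f]
  have hcell : ∀ i j, i < m → j < m → j < ν.part i := fun i j hi hj => by rw [hν i hi]; exact hj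
  have hinj : ∀ (t r o : ℕ) (_ : ∀ x < r, o + x < m ∧ o + x ≤ t ∧ t - (o + x) < m),
      r ≤ Nat.card {a // diagIdx T a = t} := by
    intro t r o h
    let φ : Fin r → {a // diagIdx T a = t} := fun x =>
      ⟨T.symm ⟨(o + x.1, t - (o + x.1)),
        hcell _ _ (h x.1 x.2).1 (h x.1 x.2).2.2⟩, by
          have := (h x.1 x.2).2.1
          simp only [diagIdx, Equiv.apply_symm_apply]
          omega⟩
    have hφ : Function.Injective φ := by
      intro x y hxy
      simp only [φ, Subtype.mk.injEq, EmbeddingLike.apply_eq_iff_eq, Prod.mk.injEq] at hxy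
      ext
      omega
    simpa using Nat.card_le_card_of_injective φ hφ
  rw [hcard]
  have hf : ∀ i : Fin (2*m), Nat.card {a // f a = i} = Nat.card {a // diagIdx T a = i.1} :=
    fun i => Nat.card_congr (Equiv.subtypeEquivRight fun a => by simp [f, Fin.ext_iff])
  simp only [hf]
  rw [Fin.prod_univ_eq_prod_range (fun i => (Nat.card {a // diagIdx T a = i}).factorial) (2*m),
    two_mul, Finset.prod_range_add, Finset.prod_mul_distrib]
  refine Nat.mul_le_mul ?_ ?_
  · refine Finset.prod_le_prod' fun k hk => Nat.factorial_le (hinj k (k+1) 0 ?_)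
    have := Finset.mem_range.mp hk
    intro x hx
    omega
  · rw [← Finset.prod_range_reflect]
    refine Finset.prod_le_prod' fun k hk => Nat.factorial_le (hinj (m+k) (m-1-k) (k+1) ?_)
    have := Finset.mem_range.mp hk
    intro x hx
    omega

/-- **Lemma 3.11** (restated via the dimension of the minimal left ideal, which equals
`deg χ_λ`). Let `q > 0` be real and `m` a positive integer with `m² > e⁴q²`. For the
square partition `λ = (m^m) ⊢ n = m²` and any Young tableau `T` of shape `λ`, the
`F`-dimension of the left ideal `F[S_n]·e_T` (the degree of `χ_λ`) exceeds `q^{m²}`. -/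
theorem square_partition_ideal_dim_gt
    (F : Type*) [Field F] [CharZero F] (q : ℝ) (hq : 0 < q) (m : ℕ) (hm : 1 ≤ m)
    (hbig : Real.exp 1 ^ 4 * q ^ 2 < ((m ^ 2 : ℕ) : ℝ))
    (ν : NPartition (m ^ 2)) (hν : ∀ i, i < m → ν.part i = m) (T : YTableau ν) :
    q ^ (m ^ 2) <
      ((Module.finrank F
        ↥((Submodule.span (MonoidAlgebra F (Equiv.Perm (Fin (m ^ 2))))
            {youngSym F T}).restrictScalars F)) : ℝ) := by
  have h1 := (card_diag m ν hν T).trans (card_le_finrank F T)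
  have h2 : diagProd m ≤ ((Module.finrank F
        ↥((Submodule.span (MonoidAlgebra F (Equiv.Perm (Fin (m ^ 2))))
            {youngSym F T}).restrictScalars F)) : ℝ) := by
    refine le_trans (le_of_eq ?_) (Nat.cast_le.mpr h1)
    simp [diagProd]
  refine lt_of_lt_of_le ?_ h2
  have h3 := diagProd_lb m
  have he : 0 < Real.exp 1 := Real.exp_pos 1
  generalize Real.exp 1 = e at *
  have h4 : e ^ 2 * q < m := by
    refine lt_of_pow_lt_pow_left₀ 2 (by positivity) ?_
    push_cast at hbig
    calc (e^2*q)^2 = e^4*q^2 := by ring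
      _ < _ := hbig
  have h5 : (e^2*q)^(m^2) < (m:ℝ)^(m^2) :=
    pow_lt_pow_left₀ h4 (by positivity) (by positivity)
  rw [mul_pow, ← pow_mul] at h5
  exact lt_of_mul_lt_mul_left (h5.trans_le h3) (by positivity)

end SSA
end
end

section
/- (Lemma 3.12.) Let F be a field of characteristic zero, λ ⊢ n and μ ⊢ m partitions with m ≤ n and the Young diagram of μ contained in the Young diagram of λ. Let T_λ be a Young tableau of shape λ in which the integers 1,2,…,m occupy exactly the cells of the subdiagram of shape μ, and let T_μ be the resulting Young tableau of shape μ (on the entries 1,…,m). Regard e_{T_μ} as an element of F[Perm(Fin n)] via the embedding Perm(Fin m) ↪ Perm(Fin n) as permutations fixing m+1,…,n. Then there exist a, b ∈ F[Perm(Fin n)] such that e_{T_λ} = a * e_{T_μ} * b. -/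
open scoped Classical

noncomputable section

namespace SSA

variable (F : Type*) [Field F]

variable {F}

variable (F)

/-- Row sum. -/
def rowSum (F : Type*) [Field F] {k : ℕ} {μ : NPartition k} (T : YTableau μ) :
    MonoidAlgebra F (Equiv.Perm (Fin k)) :=
  ∑ σ ∈ Finset.univ.filter (· ∈ rowStab T), MonoidAlgebra.single σ (1 : F)

/-- Signed column sum. -/
def colSum (F : Type*) [Field F] {k : ℕ} {μ : NPartition k} (T : YTableau μ) :
    MonoidAlgebra F (Equiv.Perm (Fin k)) :=
  ∑ τ ∈ Finset.univ.filter (· ∈ colStab T),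
    (Equiv.Perm.sign τ : ℤ) • MonoidAlgebra.single τ (1 : F)

theorem youngSym_eq_rowSum_mul_colSum (F : Type*) [Field F] {k : ℕ} {μ : NPartition k}
    (T : YTableau μ) : youngSym F T = rowSum F T * colSum F T := by
  simp only [youngSym, rowSum, colSum, Finset.sum_mul_sum, mul_smul_comm,
    MonoidAlgebra.single_mul_single, mul_one]

theorem rowSum_mul_single (F : Type*) [Field F] {k : ℕ} {μ : NPartition k}
    (T : YTableau μ) (π : Equiv.Perm (Fin k)) (hπ : π ∈ rowStab T) :
    rowSum F T * MonoidAlgebra.single π (1 : F) = rowSum F T := by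
  simp only [rowSum, Finset.sum_mul, MonoidAlgebra.single_mul_single, mul_one]
  refine Finset.sum_equiv (Equiv.mulRight π) ?_ (fun _ _ => rfl)
  intro σ
  simp only [Finset.mem_filter, Finset.mem_univ, true_and, Equiv.coe_mulRight]
  simp only [rowStab, Set.mem_ofPred_eq, Equiv.Perm.mul_apply] at hπ ⊢
  constructor
  · intro h a
    rw [h, hπ]
  · intro h a
    have h1 := h (π⁻¹ a)
    have h2 := hπ (π⁻¹ a)
    have h3 : π (π⁻¹ a) = a := by simp
    rw [h3] at h1 h2
    rw [h1, h2]

theorem single_mul_colSum (F : Type*) [Field F] {k : ℕ} {μ : NPartition k}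
    (T : YTableau μ) (π : Equiv.Perm (Fin k)) (hπ : π ∈ colStab T) :
    ((Equiv.Perm.sign π : ℤ) • MonoidAlgebra.single π (1 : F)) * colSum F T = colSum F T := by
  simp only [colSum, Finset.mul_sum, smul_mul_smul_comm, MonoidAlgebra.single_mul_single, mul_one]
  refine Finset.sum_equiv (Equiv.mulLeft π) ?_ ?_
  · intro σ
    simp only [Finset.mem_filter, Finset.mem_univ, true_and, Equiv.coe_mulLeft]
    simp only [colStab, Set.mem_ofPred_eq, Equiv.Perm.mul_apply] at hπ ⊢
    simp only [hπ]
  · intro σ _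
    simp

theorem sign_via {n m : ℕ} (ι : Fin m ↪ Fin n) (π : Equiv.Perm (Fin m)) :
    Equiv.Perm.sign (π.viaEmbedding ι) = Equiv.Perm.sign π := by
  rw [Equiv.Perm.viaEmbedding]
  convert Equiv.Perm.sign_extendDomain π (Equiv.ofInjective ι.1 ι.2)

theorem via_mem_gen {n m : ℕ} (hmn : m ≤ n) (π : Equiv.Perm (Fin m)) (f : Fin n → ℕ)
    (h : ∀ a, f (Fin.castLE hmn (π a)) = f (Fin.castLE hmn a)) (a : Fin n) :
    f (Equiv.Perm.viaEmbeddingHom (Fin.castLEEmb hmn) π a) = f a := by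
  rw [Equiv.Perm.viaEmbeddingHom_apply]
  by_cases ha : a ∈ Set.range (Fin.castLEEmb hmn)
  · obtain ⟨b, rfl⟩ := ha
    rw [Equiv.Perm.viaEmbedding_apply]
    exact h b
  · rw [Equiv.Perm.viaEmbedding_apply_of_notMem _ _ _ ha]

/-- **Lemma 3.12.** Let `λ ⊢ n` and `μ ⊢ m` with `m ≤ n` and the diagram of `μ`
contained in that of `λ`. Let `T_λ` be a Young tableau of shape `λ` in which the entries
`1,…,m` occupy exactly the cells of the subdiagram of shape `μ`, and `T_μ` the resulting
tableau of shape `μ`. Regarding `e_{T_μ} ∈ F[S_m]` inside `F[S_n]` via the embedding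
`S_m ↪ S_n` (permutations fixing `m+1,…,n`), there are `a, b ∈ F[S_n]` with
`e_{T_λ} = a * e_{T_μ} * b`. -/
theorem youngSym_eq_mul_sub_youngSym_mul
    (F : Type*) [Field F] [CharZero F] {n m : ℕ} (hmn : m ≤ n)
    (lam : NPartition n) (mu : NPartition m)
    (hsub : ∀ i, mu.part i ≤ lam.part i)
    (T : YTableau lam)
    (hT : ∀ a : Fin n, ((a : ℕ) < m ↔ (T a).1.2 < mu.part (T a).1.1))
    (Tm : YTableau mu)
    (hTm : ∀ a : Fin m, ((Tm a).1 : ℕ × ℕ) = (T (Fin.castLE hmn a)).1) :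
    ∃ a b : MonoidAlgebra F (Equiv.Perm (Fin n)),
      youngSym F T =
        a * (MonoidAlgebra.mapDomainRingHom F
              (Equiv.Perm.viaEmbeddingHom (Fin.castLEEmb hmn)) (youngSym F Tm)) * b := by
  have hr : ∀ π ∈ rowStab Tm,
      Equiv.Perm.viaEmbeddingHom (Fin.castLEEmb hmn) π ∈ rowStab T := by
    intro π hπ a
    refine via_mem_gen hmn π (fun a => (T a).1.1) (fun a => ?_) a
    simp only [← hTm]
    exact hπ a
  have hc : ∀ π ∈ colStab Tm,
      Equiv.Perm.viaEmbeddingHom (Fin.castLEEmb hmn) π ∈ colStab T := by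
    intro π hπ a
    refine via_mem_gen hmn π (fun a => (T a).1.2) (fun a => ?_) a
    simp only [← hTm]
    exact hπ a
  set φ := MonoidAlgebra.mapDomainRingHom F (Equiv.Perm.viaEmbeddingHom (Fin.castLEEmb hmn))
    with hφ
  have hφs : ∀ π, φ (MonoidAlgebra.single π (1 : F)) =
      MonoidAlgebra.single (Equiv.Perm.viaEmbeddingHom (Fin.castLEEmb hmn) π) (1 : F) := by
    intro π
    simp [hφ]
  have hR : rowSum F T * φ (rowSum F Tm) =
      ((Finset.univ.filter (· ∈ rowStab Tm)).card : F) • rowSum F T := by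
    rw [rowSum.eq_1 F Tm, map_sum, Finset.mul_sum, Finset.sum_congr rfl
      (g := fun _ => rowSum F T), Finset.sum_const, Nat.cast_smul_eq_nsmul]
    intro π hπ
    rw [hφs]
    exact rowSum_mul_single F T _ (hr π (by simpa using hπ))
  have hC : φ (colSum F Tm) * colSum F T =
      ((Finset.univ.filter (· ∈ colStab Tm)).card : F) • colSum F T := by
    rw [colSum.eq_1 F Tm, map_sum, Finset.sum_mul, Finset.sum_congr rfl
      (g := fun _ => colSum F T), Finset.sum_const, Nat.cast_smul_eq_nsmul]
    intro π hπ
    have := single_mul_colSum F T _ (hc π (by simpa using hπ))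
    rw [map_zsmul, hφs]
    rw [Equiv.Perm.viaEmbeddingHom_apply, sign_via] at this
    rw [Equiv.Perm.viaEmbeddingHom_apply]
    exact this
  have hr0 : ((Finset.univ.filter (· ∈ rowStab Tm)).card : F) ≠ 0 := by
    rw [Nat.cast_ne_zero, Finset.card_ne_zero]
    exact ⟨1, by
      simp only [Finset.mem_filter, Finset.mem_univ, true_and]
      exact fun _ => rfl⟩
  have hc0 : ((Finset.univ.filter (· ∈ colStab Tm)).card : F) ≠ 0 := by
    rw [Nat.cast_ne_zero, Finset.card_ne_zero]
    exact ⟨1, by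
      simp only [Finset.mem_filter, Finset.mem_univ, true_and]
      exact fun _ => rfl⟩
  refine ⟨((Finset.univ.filter (· ∈ rowStab Tm)).card : F)⁻¹ • rowSum F T,
    ((Finset.univ.filter (· ∈ colStab Tm)).card : F)⁻¹ • colSum F T, ?_⟩
  rw [youngSym_eq_rowSum_mul_colSum, youngSym_eq_rowSum_mul_colSum, map_mul, ← mul_assoc,
    smul_mul_assoc, hR, inv_smul_smul₀ hr0, mul_assoc, mul_smul_comm, hC, inv_smul_smul₀ hc0]

end SSA
end
end
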